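/- Dimension d ≥ 5, a > 0: there exist constants C, c > 0 (depending only on d and a) such that for every ε ∈ (0, 1/2] and x, z ∈ ℝ^d, ∫_{ℝ^d} ξ_ε(z−y) ξ_ε(x−y) dy ≤ C exp(−c ε|x−z|)( (1+|x−z|)^{4−d} + ε^{d−4} ), where ξ_ε(w) := exp(−a ε |w|)(1+|w|)^{2−d}. -/

import Mathlib

open MeasureTheory

/-- Green's function kernel `ξ_ε(w) = exp(−aε|w|)(1+|w|)^{2−d}`. -/
noncomputable def xiK (d : ℕ) (a ε : ℝ) (w : EuclideanSpace ℝ (Fin d)) : ℝ :=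
  Real.exp (-(a * ε * ‖w‖)) * (1 + ‖w‖) ^ ((2:ℝ) - d)

/-- The singular profile `|w|^{2−d}(|w|+R)^{2−d}` dominating the massless convolution integrand. -/
noncomputable def singularProfile (d : ℕ) (R : ℝ) (w : EuclideanSpace ℝ (Fin d)) : ℝ :=
  ‖w‖ ^ ((2:ℝ) - d) * (‖w‖ + R) ^ ((2:ℝ) - d)

lemma singularProfile_nonneg (d : ℕ) {R : ℝ} (hR : 0 ≤ R) (w : EuclideanSpace ℝ (Fin d)) :
    0 ≤ singularProfile d R w := by
  unfold singularProfile; positivity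

lemma singularProfile_eq_scaled (d : ℕ) {R : ℝ} (hR : 0 < R) (w : EuclideanSpace ℝ (Fin d)) :
    singularProfile d R w = R ^ (2 * ((2:ℝ) - d)) * singularProfile d 1 (R⁻¹ • w) := by
  have h₁ : ‖w‖ = R * ‖R⁻¹ • w‖ := by
    rw [norm_smul, norm_inv, Real.norm_of_nonneg hR.le, mul_inv_cancel_left₀ hR.ne']
  have h₂ : ‖w‖ + R = R * (‖R⁻¹ • w‖ + 1) := by rw [mul_add, ← h₁, mul_one]
  unfold singularProfile
  rw [h₂, h₁, Real.mul_rpow hR.le (norm_nonneg _), Real.mul_rpow hR.le (by positivity),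
    two_mul ((2:ℝ) - d), Real.rpow_add hR]
  ring

lemma integrable_singularProfile_one {d : ℕ} (hd : 5 ≤ d) :
    Integrable (singularProfile d 1) := by
  have : Nonempty (Fin d) := ⟨⟨0, by omega⟩⟩
  have hd' : (5:ℝ) ≤ d := by exact_mod_cast hd
  refine (integrable_fun_norm_addHaar (volume : Measure (EuclideanSpace ℝ (Fin d)))
    (f := fun t : ℝ => t ^ ((2:ℝ) - d) * (t + 1) ^ ((2:ℝ) - d))).2 ?_
  have hint : Integrable (fun t : ℝ => (1 + ‖t‖) ^ (-((d:ℝ) - 3))) := by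
    refine integrable_one_add_norm ?_
    simp only [Module.finrank_self, Nat.cast_one]; linarith
  refine (hint.integrableOn (s := Set.Ioi 0)).mono' ?_ ?_
  · exact Measurable.aestronglyMeasurable (by fun_prop)
  · refine (ae_restrict_iff' measurableSet_Ioi).2 (Filter.Eventually.of_forall fun t ht => ?_)
    have ht : 0 < t := ht
    rw [Real.norm_of_nonneg (by positivity), Real.norm_of_nonneg ht.le, finrank_euclideanSpace,
      Fintype.card_fin, smul_eq_mul, ← mul_assoc, ← Real.rpow_natCast, ← Real.rpow_add ht,
      Nat.cast_sub (by omega : 1 ≤ d), Nat.cast_one,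
      show (d:ℝ) - 1 + (2 - d) = 1 by ring, Real.rpow_one, add_comm t 1,
      show -((d:ℝ) - 3) = 1 + (2 - d) by ring, Real.rpow_add (by positivity), Real.rpow_one]
    gcongr
    linarith

lemma integrable_singularProfile {d : ℕ} (hd : 5 ≤ d) {R : ℝ} (hR : 0 < R) :
    Integrable (singularProfile d R) := by
  rw [funext (singularProfile_eq_scaled d hR)]
  exact ((integrable_singularProfile_one hd).comp_smul (inv_ne_zero hR.ne')).const_mul _

lemma integral_singularProfile (d : ℕ) {R : ℝ} (hR : 0 < R) :
    ∫ w, singularProfile d R w = R ^ ((4:ℝ) - d) * ∫ w, singularProfile d 1 w := by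
  simp_rw [singularProfile_eq_scaled d hR]
  rw [integral_const_mul, Measure.integral_comp_inv_smul_of_nonneg _ _ hR.le,
    finrank_euclideanSpace, Fintype.card_fin, smul_eq_mul, ← mul_assoc, ← Real.rpow_natCast,
    ← Real.rpow_add hR]
  ring_nf

lemma rpow_mul_rpow_le_of_le {m s t R : ℝ} (hm : m ≤ 0) (hs : 0 < s) (hst : s ≤ t)
    (hR : 0 < R) (hRst : R ≤ 1 + (s + t)) :
    (1 + s) ^ m * (1 + t) ^ m ≤ 3 ^ (-m) * (s ^ m * (s + R) ^ m) := by
  have ht : 0 < t := hs.trans_le hst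
  have h₁ : (1 + s) ^ m ≤ s ^ m := Real.rpow_le_rpow_of_nonpos hs (by linarith) hm
  have h₂ : (1 + t) ^ m ≤ ((s + R) / 3) ^ m :=
    Real.rpow_le_rpow_of_nonpos (by positivity) (by linarith) hm
  rw [Real.div_rpow (by positivity) (by norm_num), div_eq_mul_inv,
    ← Real.rpow_neg (by norm_num)] at h₂
  calc (1 + s) ^ m * (1 + t) ^ m ≤ s ^ m * ((s + R) ^ m * 3 ^ (-m)) := by gcongr
    _ = _ := by ring

lemma rpow_mul_rpow_le {m s t R : ℝ} (hm : m ≤ 0) (hs : 0 < s) (ht : 0 < t)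
    (hR : 0 < R) (hRst : R ≤ 1 + (s + t)) :
    (1 + s) ^ m * (1 + t) ^ m
      ≤ 3 ^ (-m) * (s ^ m * (s + R) ^ m + t ^ m * (t + R) ^ m) := by
  rw [mul_add]
  rcases le_total s t with h | h
  · exact (rpow_mul_rpow_le_of_le hm hs h hR hRst).trans
      (le_add_of_nonneg_right (by positivity))
  · rw [mul_comm ((1 + s) ^ m)]
    exact (rpow_mul_rpow_le_of_le hm ht h hR (by linarith)).trans
      (le_add_of_nonneg_left (by positivity))

lemma xiK_nonneg (d : ℕ) (a ε : ℝ) (w : EuclideanSpace ℝ (Fin d)) : 0 ≤ xiK d a ε w := by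
  unfold xiK; positivity

lemma xiK_mul_xiK_le {d : ℕ} (hd : 2 ≤ d) {a ε : ℝ} (ha : 0 ≤ a) (hε : 0 ≤ ε)
    {x z y : EuclideanSpace ℝ (Fin d)} (hz : y ≠ z) (hx : y ≠ x) :
    xiK d a ε (z - y) * xiK d a ε (x - y)
      ≤ Real.exp (-(a * ε * ‖x - z‖)) * 3 ^ ((d:ℝ) - 2) *
        (singularProfile d (1 + ‖x - z‖) (z - y) + singularProfile d (1 + ‖x - z‖) (x - y)) := by
  have htri : ‖x - z‖ ≤ ‖z - y‖ + ‖x - y‖ := by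
    rw [norm_sub_rev z y, add_comm]; exact norm_sub_le_norm_sub_add_norm_sub x y z
  have hd' : (2:ℝ) ≤ d := by exact_mod_cast hd
  have hpow := rpow_mul_rpow_le (m := (2:ℝ) - d) (R := 1 + ‖x - z‖) (by linarith)
    (norm_pos_iff.2 (sub_ne_zero.2 hz.symm)) (norm_pos_iff.2 (sub_ne_zero.2 hx.symm))
    (by positivity) (by linarith)
  rw [neg_sub] at hpow
  have hexp : Real.exp (-(a * ε * ‖z - y‖)) * Real.exp (-(a * ε * ‖x - y‖))
      ≤ Real.exp (-(a * ε * ‖x - z‖)) := by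
    rw [← Real.exp_add, Real.exp_le_exp]
    nlinarith [mul_le_mul_of_nonneg_left htri (mul_nonneg ha hε)]
  unfold xiK singularProfile
  rw [mul_mul_mul_comm, mul_assoc (Real.exp (-(a * ε * ‖x - z‖)))]
  exact mul_le_mul hexp hpow (by positivity) (by positivity)

/-- Convolution estimate for the Green's function kernel in dimension `d ≥ 5`:
`∫ ξ_ε(z−y)ξ_ε(x−y) dy ≤ C exp(−cε|x−z|)((1+|x−z|)^{4−d} + ε^{d−4})`. -/
theorem stmt10 (d : ℕ) (hd : 5 ≤ d) (a : ℝ) (ha : 0 < a) :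
    ∃ C > (0:ℝ), ∃ c > (0:ℝ), ∀ ε ∈ Set.Ioc (0:ℝ) (1/2),
      ∀ x z : EuclideanSpace ℝ (Fin d),
        (∫ y : EuclideanSpace ℝ (Fin d), xiK d a ε (z - y) * xiK d a ε (x - y))
          ≤ C * Real.exp (-(c * ε * ‖x - z‖)) *
              ((1 + ‖x - z‖) ^ ((4:ℝ) - d) + ε ^ ((d:ℝ) - 4)) := by
  have : Nonempty (Fin d) := ⟨⟨0, by omega⟩⟩
  set I : ℝ := ∫ w, singularProfile d 1 w
  have hI : 0 ≤ I := integral_nonneg (singularProfile_nonneg d zero_le_one)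
  refine ⟨3 ^ ((d:ℝ) - 2) * (2 * I) + 1, by positivity, a, ha, fun ε hε x z => ?_⟩
  have hε₀ : 0 < ε := hε.1
  have hR : 0 < 1 + ‖x - z‖ := by positivity
  have hG := integrable_singularProfile hd hR
  calc ∫ y, xiK d a ε (z - y) * xiK d a ε (x - y)
      ≤ ∫ y, Real.exp (-(a * ε * ‖x - z‖)) * 3 ^ ((d:ℝ) - 2) *
          (singularProfile d (1 + ‖x - z‖) (z - y)
            + singularProfile d (1 + ‖x - z‖) (x - y)) := by
        refine integral_mono_of_nonneg
          (Filter.Eventually.of_forall fun y => mul_nonneg (xiK_nonneg ..) (xiK_nonneg ..))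
          (((hG.comp_sub_left z).add (hG.comp_sub_left x)).const_mul _) ?_
        filter_upwards [Measure.ae_ne volume z, Measure.ae_ne volume x] with y hz hx
        exact xiK_mul_xiK_le (by omega) ha.le hε₀.le hz hx
    _ = 3 ^ ((d:ℝ) - 2) * (2 * I) * Real.exp (-(a * ε * ‖x - z‖)) *
          (1 + ‖x - z‖) ^ ((4:ℝ) - d) := by
        rw [integral_const_mul, integral_add (hG.comp_sub_left z) (hG.comp_sub_left x),
          integral_sub_left_eq_self (singularProfile d (1 + ‖x - z‖)) volume z,
          integral_sub_left_eq_self (singularProfile d (1 + ‖x - z‖)) volume x,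
          integral_singularProfile d hR]
        ring
    _ ≤ (3 ^ ((d:ℝ) - 2) * (2 * I) + 1) * Real.exp (-(a * ε * ‖x - z‖)) *
          ((1 + ‖x - z‖) ^ ((4:ℝ) - d) + ε ^ ((d:ℝ) - 4)) := by
        gcongr
        · exact le_add_of_nonneg_right zero_le_one
        · exact le_add_of_nonneg_right (by positivity)
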